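/- arXiv:1607.08053 — 2 statements merged into one kernel-verified Lean document; each statement's English description precedes it below -/
import Mathlib

section
/- Let (u_n)_{n≥2} be a sequence of real numbers with 1 < u_2 < u_3 < …, and let (a_n)_{n≥2} be real numbers such that the series Σ_{n≥2} |a_n| u_n^{−2σ} converges for every real σ > 1. Define H(s) = 1 + Σ_{n≥2} a_n u_n^{−2s} for complex s with Re(s) > 1. Then for every natural number k there exist constants β_k > 1, C_k > 0 and σ_0 > 1 such that H(s) ≠ 0 for Re(s) ≥ σ_0 and the k-th derivative of log H(s) satisfies |d^k/ds^k log H(s)| ≤ C_k · β_k^{−Re(s)} for all s with Re(s) ≥ σ_0. -/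
open Complex Real Filter

/-- A holomorphic function bounded by `K β^{-Re s}` on a right half-plane has all its derivatives
bounded by a multiple of `β^{-Re s}` on a smaller half-plane. -/
lemma norm_iteratedDeriv_le_rpow_neg_re {f : ℂ → ℂ} {σ₁ K β : ℝ} (hβ : 1 < β) (hK : 0 ≤ K)
    (hf : DifferentiableOn ℂ f {s | σ₁ < s.re})
    (hbound : ∀ s : ℂ, σ₁ < s.re → ‖f s‖ ≤ K * β ^ (-s.re)) (k : ℕ) {s : ℂ}
    (hs : σ₁ + 2 ≤ s.re) :
    ‖iteratedDeriv k f s‖ ≤ (k.factorial * (K * β)) * β ^ (-s.re) := by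
  have hre : ∀ z ∈ Metric.closedBall s 1, s.re - 1 ≤ z.re := fun z hz => by
    have h := (abs_re_le_norm (z - s)).trans (mem_closedBall_iff_norm.1 hz)
    rw [sub_re] at h
    linarith [(abs_le.1 h).1]
  have hd : DiffContOnCl ℂ f (Metric.ball s 1) := by
    refine (hf.mono fun z hz => ?_).diffContOnCl
    rw [closure_ball s one_ne_zero] at hz
    have := hre z hz
    simp only [Set.mem_ofPred_eq]
    linarith
  have hsphere : ∀ z ∈ Metric.sphere s 1, ‖f z‖ ≤ K * β * β ^ (-s.re) := fun z hz => by
    have h := hre z (Metric.sphere_subset_closedBall hz)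
    refine (hbound z (by linarith)).trans ?_
    have hβs : β * β ^ (-s.re) = β ^ (1 - s.re) := by
      rw [sub_eq_add_neg, Real.rpow_add (by linarith), Real.rpow_one]
    rw [mul_assoc, hβs]
    gcongr
    · exact hβ.le
    · linarith
  have := norm_iteratedDeriv_le_of_forall_mem_sphere_norm_le k one_pos hd hsphere
  simpa [mul_assoc] using this

section Series

variable {b v : ℕ → ℝ} {U : ℝ}

lemma norm_dirichlet_term_le (hU : 1 < U) (hv : ∀ n, U ≤ v n) {σ₁ : ℝ} (n : ℕ) {s : ℂ}
    (hs : σ₁ ≤ s.re) :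
    ‖(b n : ℂ) * (v n : ℂ) ^ (-(2 * s))‖ ≤
      |b n| * v n ^ (-(2 * σ₁)) * U ^ (-(2 * (s.re - σ₁))) := by
  have hU0 : 0 < U := by linarith
  have hv0 : 0 < v n := hU0.trans_le (hv n)
  have hre : (-(2 * s)).re = -(2 * σ₁) + -(2 * (s.re - σ₁)) := by simp; ring
  rw [norm_mul, norm_real, Real.norm_eq_abs, norm_cpow_eq_rpow_re_of_pos hv0, hre,
    Real.rpow_add hv0, mul_assoc]
  gcongr _ * (_ * ?_)
  exact Real.rpow_le_rpow_of_nonpos hU0 (hv n) (by linarith)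

lemma norm_dirichlet_tsum_le (hU : 1 < U) (hv : ∀ n, U ≤ v n) {σ₁ : ℝ}
    (hsum : Summable fun n => |b n| * v n ^ (-(2 * σ₁))) {s : ℂ} (hs : σ₁ ≤ s.re) :
    ‖∑' n, (b n : ℂ) * (v n : ℂ) ^ (-(2 * s))‖ ≤
      (∑' n, |b n| * v n ^ (-(2 * σ₁))) * U ^ (-(2 * (s.re - σ₁))) :=
  tsum_of_norm_bounded (hsum.hasSum.mul_right _) fun n => norm_dirichlet_term_le hU hv n hs

lemma differentiableOn_dirichlet_tsum (hU : 1 < U) (hv : ∀ n, U ≤ v n) {σ₁ : ℝ}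
    (hsum : Summable fun n => |b n| * v n ^ (-(2 * σ₁))) :
    DifferentiableOn ℂ (fun s : ℂ => ∑' n, (b n : ℂ) * (v n : ℂ) ^ (-(2 * s)))
      {s | σ₁ < s.re} := by
  refine differentiableOn_tsum_of_summable_norm hsum (fun n => ?_)
    (isOpen_lt continuous_const continuous_re) fun n s hs => ?_
  · have hv0 : (v n : ℂ) ≠ 0 := ofReal_ne_zero.2 (by linarith [hv n])
    have hexp : Differentiable ℂ fun s : ℂ => -(2 * s) := by fun_prop
    exact ((hexp.const_cpow (Or.inl hv0)).const_mul _).differentiableOn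
  · have hs' : σ₁ ≤ s.re := le_of_lt hs
    have hv0 : 0 ≤ v n := by linarith [hv n]
    refine (norm_dirichlet_term_le hU hv n hs').trans (mul_le_of_le_one_right (by positivity) ?_)
    exact Real.rpow_le_one_of_one_le_of_nonpos hU.le (by linarith)

end Series

/-- For a generalized Dirichlet series `H(s) = 1 + ∑_{n≥2} aₙ uₙ^{−2s}` with
`1 < u₂ < u₃ < ⋯` and `∑_{n≥2} |aₙ| uₙ^{−2σ} < ∞` for every `σ > 1`, for every `k` there
are `βₖ > 1`, `Cₖ > 0` and `σ₀ > 1` such that `H(s) ≠ 0` for `Re(s) ≥ σ₀` and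
`|dᵏ/dsᵏ log H(s)| ≤ Cₖ βₖ^{−Re(s)}` there. -/
theorem dirichlet_series_log_deriv_decay
    (u a : ℕ → ℝ)
    (hu1 : 1 < u 2)
    (humono : ∀ m : ℕ, 2 ≤ m → u m < u (m + 1))
    (hconv : ∀ σ : ℝ, 1 < σ →
      Summable (fun n : ℕ => |a (n + 2)| * (u (n + 2)) ^ (-(2 * σ))))
    (H : ℂ → ℂ)
    (hH : ∀ s : ℂ, 1 < s.re →
      H s = 1 + ∑' n : ℕ, (a (n + 2) : ℂ) * (u (n + 2) : ℂ) ^ (-(2 * s))) :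
    ∀ k : ℕ, ∃ β : ℝ, 1 < β ∧ ∃ C : ℝ, 0 < C ∧ ∃ σ₀ : ℝ, 1 < σ₀ ∧
      (∀ s : ℂ, σ₀ ≤ s.re → H s ≠ 0) ∧
      (∀ s : ℂ, σ₀ ≤ s.re →
        ‖iteratedDeriv k (fun w => Complex.log (H w)) s‖ ≤ C * β ^ (-s.re)) := by
  intro k
  have hv : ∀ n, u 2 ≤ u (n + 2) := fun n => by
    induction n with
    | zero => rfl
    | succ n ih => exact ih.trans (humono (n + 2) (by omega)).le
  have hU0 : 0 < u 2 := by linarith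
  have hsum := hconv 2 one_lt_two
  have hβ : 1 < u 2 ^ 2 := one_lt_pow₀ hu1 two_ne_zero
  set M := ∑' n, |a (n + 2)| * u (n + 2) ^ (-(2 * (2 : ℝ)))
  have hM0 : 0 ≤ M := tsum_nonneg fun n => by
    have : 0 ≤ u (n + 2) := hU0.le.trans (hv n)
    positivity
  have hH1 : ∀ s : ℂ, 2 ≤ s.re → ‖H s - 1‖ ≤ M * u 2 ^ 4 * (u 2 ^ 2) ^ (-s.re) := fun s hs => by
    rw [hH s (by linarith), add_sub_cancel_left]
    refine (norm_dirichlet_tsum_le (b := fun n => a (n + 2)) hu1 hv hsum hs).trans_eq ?_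
    rw [mul_assoc, ← Real.rpow_natCast (u 2) 4, ← Real.rpow_natCast (u 2) 2,
      ← Real.rpow_mul hU0.le, ← Real.rpow_add hU0]
    congr 2
    push_cast
    ring
  have htend : Tendsto (fun σ : ℝ => M * u 2 ^ 4 * (u 2 ^ 2) ^ (-σ)) atTop (nhds 0) := by
    have h := (tendsto_rpow_atBot_of_base_gt_one _ hβ).comp tendsto_neg_atTop_atBot
    simpa using h.const_mul (M * u 2 ^ 4)
  obtain ⟨σ₁, hσ₁⟩ := eventually_atTop.1
    ((htend.eventually_le_const (one_half_pos (α := ℝ))).and (eventually_ge_atTop 2))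
  have hσ₁2 : 2 ≤ σ₁ := (hσ₁ σ₁ le_rfl).2
  have hhalf : ∀ s : ℂ, σ₁ ≤ s.re → ‖H s - 1‖ ≤ 1 / 2 := fun s hs =>
    (hH1 s (hσ₁2.trans hs)).trans (hσ₁ s.re hs).1
  have hslit : ∀ s : ℂ, σ₁ ≤ s.re → H s ∈ slitPlane := fun s hs => by
    have := mem_slitPlane_of_norm_lt_one ((hhalf s hs).trans_lt one_half_lt_one)
    rwa [add_sub_cancel] at this
  have hdiff : DifferentiableOn ℂ (fun w => Complex.log (H w)) {s | σ₁ < s.re} := by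
    refine DifferentiableOn.clog ?_ fun s hs => hslit s (le_of_lt hs)
    refine (((differentiableOn_dirichlet_tsum (b := fun n => a (n + 2)) hu1 hv hsum).mono
      fun s hs => hσ₁2.trans_lt hs).const_add 1).congr fun s hs => hH s ?_
    have : σ₁ < s.re := hs
    linarith
  have hlog : ∀ s : ℂ, σ₁ < s.re →
      ‖Complex.log (H s)‖ ≤ 3 / 2 * (M * u 2 ^ 4) * (u 2 ^ 2) ^ (-s.re) := fun s hs => by
    have h := norm_log_one_add_half_le_self (hhalf s hs.le)
    rw [add_sub_cancel] at h
    rw [mul_assoc]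
    exact h.trans (by gcongr; exact hH1 s (hσ₁2.trans hs.le))
  refine ⟨u 2 ^ 2, hβ, k.factorial * (3 / 2 * (M * u 2 ^ 4) * u 2 ^ 2) + 1, by positivity, σ₁ + 2,
    by linarith, fun s hs => slitPlane_ne_zero (hslit s (by linarith)), fun s hs => ?_⟩
  refine (norm_iteratedDeriv_le_rpow_neg_re hβ (by positivity) hdiff hlog k hs).trans ?_
  gcongr
  exact le_add_of_nonneg_right zero_le_one
end

section
/- Let g ≥ 0 and c ≥ 0 be integers with 2g − 2 + c ≥ 0, and let d_1, …, d_e be integers with d_i ≥ 2. Define G_E(s) = ∏_{i=1}^{e} ∏_{m=0}^{d_i−1} G((s+m)/d_i + 1) and G_1(s) = ((2π)^{−s} G(s+1)² / Γ(s))^{2g−2+c} · ((2π)^{−s} G(s+1)²)^{e} · G_E(s)^{−2}. Then G_1 extends to an entire function of order at most two (for every ε > 0 there is C > 0 with |G_1(s)| ≤ C exp(|s|^{2+ε})), whose zeros are precisely the points s = −n for natural numbers n with m_n > 0, the zero at s = −n having multiplicity exactly m_n = (2n+1)(2g−2+c) + 2ne − 2Σ_{i=1}^{e} ⌊n/d_i⌋.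 -/
open Complex Real

/-- The infinite product defining the Barnes double Gamma function. -/
noncomputable def barnesProd (z : ℂ) : ℂ :=
  ∏' n : ℕ, (1 + z / (n + 1)) ^ (n + 1) * Complex.exp (-z + z ^ 2 / (2 * ((n : ℂ) + 1)))

/-- The Barnes double Gamma function: `barnesG1 z = G(z+1)`. -/
noncomputable def barnesG1 (z : ℂ) : ℂ :=
  (2 * Real.pi : ℂ) ^ (z / 2) *
    Complex.exp (-(((1 + (Real.eulerMascheroniConstant : ℂ)) * z ^ 2 + z) / 2)) * barnesProd z

/-- `G_E(s) = ∏_{i} ∏_{m=0}^{dᵢ−1} G((s+m)/dᵢ + 1)`. -/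
noncomputable def barnesGE (e : ℕ) (d : Fin e → ℕ) (s : ℂ) : ℂ :=
  ∏ i, ∏ m ∈ Finset.range (d i), barnesG1 ((s + m) / (d i))

/-- The genus-two Weierstrass factor `(1 + u) exp(-u + u²/2)`, vanishing at `u = -1`. -/
noncomputable def weierstrassFactor (u : ℂ) : ℂ :=
  (1 + u) * Complex.exp (-u + u ^ 2 / 2)

/-- The logarithm of the Weierstrass factor, used inside the unit disc. -/
noncomputable def weierstrassLog (u : ℂ) : ℂ :=
  Complex.log (1 + u) - u + u ^ 2 / 2

/-- The canonical product with a zero of multiplicity `a n` at `-(n + 1)`. -/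
noncomputable def canonicalProduct (a : ℕ → ℕ) (s : ℂ) : ℂ :=
  ∏' n : ℕ, weierstrassFactor (s / ((n : ℂ) + 1)) ^ a n

lemma weierstrassFactor_eq_exp {u : ℂ} (hu : 1 + u ≠ 0) :
    weierstrassFactor u = Complex.exp (weierstrassLog u) := by
  rw [weierstrassFactor, weierstrassLog, neg_add_eq_sub, sub_add_eq_add_sub, add_sub_assoc,
    Complex.exp_add, Complex.exp_log hu]

lemma differentiable_weierstrassFactor : Differentiable ℂ weierstrassFactor := by
  unfold weierstrassFactor
  fun_prop

lemma one_add_ne_zero_of_norm_lt_one {u : ℂ} (hu : ‖u‖ < 1) : 1 + u ≠ 0 :=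
  Complex.slitPlane_ne_zero (Complex.mem_slitPlane_of_norm_lt_one hu)

lemma norm_weierstrassLog_le {u : ℂ} (hu : ‖u‖ ≤ 1 / 2) : ‖weierstrassLog u‖ ≤ ‖u‖ ^ 3 := by
  have h := Complex.norm_log_sub_logTaylor_le 2 (z := u) (by linarith)
  have e : Complex.log (1 + u) - Complex.logTaylor (2 + 1) u = weierstrassLog u := by
    simp only [Complex.logTaylor_succ, Complex.logTaylor_zero, weierstrassLog, Pi.add_apply]
    norm_num
    ring
  rw [e] at h
  refine h.trans ?_
  have h1 : (1 - ‖u‖)⁻¹ ≤ 2 := by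
    rw [inv_le_comm₀ (by linarith) (by norm_num)]
    linarith
  have h3 : 0 ≤ ‖u‖ ^ 3 := by positivity
  norm_num
  nlinarith

lemma norm_weierstrassFactor_le {p : ℝ} (hp2 : 2 ≤ p) (hp3 : p ≤ 3) (u : ℂ) :
    ‖weierstrassFactor u‖ ≤ Real.exp (16 * ‖u‖ ^ p) := by
  have hu0 := norm_nonneg u
  rcases le_or_gt ‖u‖ (1 / 2) with hu | hu
  · rw [weierstrassFactor_eq_exp (one_add_ne_zero_of_norm_lt_one (by linarith)),
      Complex.norm_exp]
    refine Real.exp_le_exp.2 (((Complex.re_le_norm _).trans (norm_weierstrassLog_le hu)).trans ?_)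
    have : ‖u‖ ^ (3 : ℝ) ≤ ‖u‖ ^ p := by
      rcases hu0.eq_or_lt with h | h
      · rw [← h, Real.zero_rpow (by norm_num), Real.zero_rpow (by linarith)]
      · exact Real.rpow_le_rpow_of_exponent_ge h (by linarith) hp3
    have h0 : 0 ≤ ‖u‖ ^ p := by positivity
    have h3 : ‖u‖ ^ (3 : ℝ) = ‖u‖ ^ (3 : ℕ) := by rw [← Real.rpow_natCast]; norm_num
    rw [← h3]
    linarith
  · have h1 : ‖weierstrassFactor u‖ ≤ Real.exp (2 * ‖u‖ + ‖u‖ ^ 2 / 2) := by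
      rw [weierstrassFactor, norm_mul, Complex.norm_exp]
      have ha : ‖1 + u‖ ≤ Real.exp ‖u‖ := by
        refine (norm_add_le _ _).trans ?_
        rw [norm_one, add_comm]
        exact Real.add_one_le_exp _
      have hb : (-u + u ^ 2 / 2).re ≤ ‖u‖ + ‖u‖ ^ 2 / 2 := by
        refine (Complex.re_le_norm _).trans ((norm_add_le _ _).trans ?_)
        simp
      calc ‖1 + u‖ * Real.exp (-u + u ^ 2 / 2).re
          ≤ Real.exp ‖u‖ * Real.exp (‖u‖ + ‖u‖ ^ 2 / 2) := by gcongr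
        _ = _ := by rw [← Real.exp_add]; congr 1; ring
    refine h1.trans (Real.exp_le_exp.2 ?_)
    have hv : (2 * ‖u‖) ^ (2 : ℝ) ≤ (2 * ‖u‖) ^ p :=
      Real.rpow_le_rpow_of_exponent_le (by linarith) hp2
    rw [Real.mul_rpow (by norm_num) hu0 (z := p)] at hv
    have h8 : (2 : ℝ) ^ p ≤ 8 := by
      calc (2 : ℝ) ^ p ≤ 2 ^ (3 : ℝ) := Real.rpow_le_rpow_of_exponent_le (by norm_num) hp3
        _ = 8 := by norm_num
    have h0 : 0 ≤ ‖u‖ ^ p := by positivity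
    rw [Real.rpow_two] at hv
    nlinarith [mul_le_mul_of_nonneg_right h8 h0]

lemma summable_one_div_add_one_sq : Summable fun n : ℕ ↦ 1 / ((n : ℝ) + 1) ^ 2 := by
  have := (summable_nat_add_iff 1).2 (Real.summable_one_div_nat_pow (p := 2).2 (by norm_num))
  simpa using this

section CanonicalProduct

variable {a b : ℕ → ℕ} {K : ℕ}

lemma norm_div_natCast_add_one (s : ℂ) (n : ℕ) :
    ‖s / ((n : ℂ) + 1)‖ = ‖s‖ / ((n : ℝ) + 1) := by
  rw [norm_div]
  congr 1
  exact_mod_cast Complex.norm_natCast (n + 1)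

/-- Terms beyond `2R` have summable logarithms, uniformly for `‖s‖ ≤ R`. -/
lemma norm_mul_weierstrassLog_le (ha : ∀ n, a n ≤ K * (n + 1)) {R : ℝ} {M : ℕ}
    (hM : 2 * R ≤ M) {s : ℂ} (hs : ‖s‖ ≤ R) (n : ℕ) :
    ‖(a (n + M) : ℂ) * weierstrassLog (s / (((n + M : ℕ) : ℂ) + 1))‖ ≤
      K * R ^ 3 * (1 / ((n : ℝ) + 1) ^ 2) := by
  have hR : 0 ≤ R := (norm_nonneg s).trans hs
  have hn : (0 : ℝ) ≤ n := n.cast_nonneg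
  have hk : (0 : ℝ) < ((n + M : ℕ) : ℝ) + 1 := by positivity
  have hnk : (n : ℝ) + 1 ≤ ((n + M : ℕ) : ℝ) + 1 := by push_cast; linarith
  have hu : ‖s / (((n + M : ℕ) : ℂ) + 1)‖ ≤ 1 / 2 := by
    rw [norm_div_natCast_add_one, div_le_iff₀ hk]
    push_cast
    linarith
  have h := norm_weierstrassLog_le hu
  rw [norm_div_natCast_add_one] at h
  have ha' : (a (n + M) : ℝ) ≤ K * (((n + M : ℕ) : ℝ) + 1) := by exact_mod_cast ha (n + M)
  rw [norm_mul, Complex.norm_natCast]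
  calc (a (n + M) : ℝ) * ‖weierstrassLog (s / (((n + M : ℕ) : ℂ) + 1))‖
      ≤ (K * (((n + M : ℕ) : ℝ) + 1)) * (R / (((n + M : ℕ) : ℝ) + 1)) ^ 3 := by
        refine mul_le_mul ha' (h.trans ?_) (norm_nonneg _) (by positivity)
        gcongr
    _ = K * R ^ 3 * (1 / (((n + M : ℕ) : ℝ) + 1) ^ 2) := by field_simp
    _ ≤ _ := by gcongr

lemma one_add_div_ne_zero {R : ℝ} {M : ℕ} (hM : 2 * R ≤ M) {s : ℂ} (hs : ‖s‖ ≤ R) (n : ℕ) :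
    1 + s / (((n + M : ℕ) : ℂ) + 1) ≠ 0 := by
  apply one_add_ne_zero_of_norm_lt_one
  have hn : (0 : ℝ) ≤ n := n.cast_nonneg
  have := norm_nonneg s
  rw [norm_div_natCast_add_one, div_lt_one (by positivity)]
  push_cast
  linarith

/-- On `‖s‖ ≤ R`, the canonical product is a finite product times an exponential. -/
lemma hasProd_weierstrassFactor_split (ha : ∀ n, a n ≤ K * (n + 1)) {R : ℝ} {M : ℕ}
    (hM : 2 * R ≤ M) {s : ℂ} (hs : ‖s‖ ≤ R) :
    HasProd (fun n : ℕ ↦ weierstrassFactor (s / ((n : ℂ) + 1)) ^ a n)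
      ((∏ n ∈ Finset.range M, weierstrassFactor (s / ((n : ℂ) + 1)) ^ a n) *
        Complex.exp (∑' n : ℕ, (a (n + M) : ℂ) *
          weierstrassLog (s / (((n + M : ℕ) : ℂ) + 1)))) := by
  apply HasProd.prod_range_mul
  have hsum : Summable fun n : ℕ ↦ (a (n + M) : ℂ) *
      weierstrassLog (s / (((n + M : ℕ) : ℂ) + 1)) :=
    Summable.of_norm_bounded (summable_one_div_add_one_sq.mul_left (K * R ^ 3))
      (norm_mul_weierstrassLog_le ha hM hs)
  convert! hsum.hasSum.cexp using 1
  funext n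
  rw [Function.comp_apply, Complex.exp_nat_mul,
    ← weierstrassFactor_eq_exp (one_add_div_ne_zero hM hs n)]

lemma hasProd_canonicalProduct (ha : ∀ n, a n ≤ K * (n + 1)) (s : ℂ) :
    HasProd (fun n : ℕ ↦ weierstrassFactor (s / ((n : ℂ) + 1)) ^ a n) (canonicalProduct a s) :=
  (hasProd_weierstrassFactor_split ha (Nat.le_ceil (2 * ‖s‖)) le_rfl).multipliable.hasProd

lemma canonicalProduct_eq_split (ha : ∀ n, a n ≤ K * (n + 1)) {R : ℝ} {M : ℕ}
    (hM : 2 * R ≤ M) {s : ℂ} (hs : ‖s‖ ≤ R) :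
    canonicalProduct a s = (∏ n ∈ Finset.range M, weierstrassFactor (s / ((n : ℂ) + 1)) ^ a n) *
        Complex.exp (∑' n : ℕ, (a (n + M) : ℂ) *
          weierstrassLog (s / (((n + M : ℕ) : ℂ) + 1))) :=
  (hasProd_weierstrassFactor_split ha hM hs).tprod_eq

lemma differentiable_canonicalProduct (ha : ∀ n, a n ≤ K * (n + 1)) :
    Differentiable ℂ (canonicalProduct a) := by
  intro s
  set R : ℝ := ‖s‖ + 1
  set M : ℕ := ⌈2 * R⌉₊
  have hM : 2 * R ≤ M := Nat.le_ceil _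
  have hmem : s ∈ Metric.ball (0 : ℂ) R := by simp [R]
  have hle : ∀ w ∈ Metric.ball (0 : ℂ) R, ‖w‖ ≤ R := fun w hw ↦ (mem_ball_zero_iff.1 hw).le
  suffices DifferentiableOn ℂ (canonicalProduct a) (Metric.ball 0 R) from
    this.differentiableAt (Metric.isOpen_ball.mem_nhds hmem)
  refine DifferentiableOn.congr ?_ fun w hw ↦ canonicalProduct_eq_split ha hM (hle w hw)
  refine DifferentiableOn.mul ?_ (DifferentiableOn.cexp ?_)
  · refine Differentiable.differentiableOn ?_
    refine Differentiable.fun_finsetProd fun n _ ↦ Differentiable.pow ?_ _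
    exact differentiable_weierstrassFactor.comp (by fun_prop)
  · refine Complex.differentiableOn_tsum_of_summable_norm
      (summable_one_div_add_one_sq.mul_left (K * R ^ 3)) (fun n w hw ↦ ?_)
      Metric.isOpen_ball fun n w hw ↦ norm_mul_weierstrassLog_le ha hM (hle w hw) n
    apply DifferentiableAt.differentiableWithinAt
    have hslit : 1 + w / (((n + M : ℕ) : ℂ) + 1) ∈ Complex.slitPlane := by
      apply Complex.mem_slitPlane_of_norm_lt_one
      have hn : (0 : ℝ) ≤ n := n.cast_nonneg
      have := norm_nonneg w
      have := hle w hw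
      rw [norm_div_natCast_add_one, div_lt_one (by positivity)]
      push_cast
      linarith
    unfold weierstrassLog
    fun_prop (disch := exact hslit)

lemma weierstrassFactor_div_eq_zero_iff {s : ℂ} {n : ℕ} :
    weierstrassFactor (s / ((n : ℂ) + 1)) = 0 ↔ s = -((n : ℂ) + 1) := by
  have hn : (n : ℂ) + 1 ≠ 0 := Nat.cast_add_one_ne_zero n
  simp only [weierstrassFactor, mul_eq_zero, Complex.exp_ne_zero, or_false]
  rw [← mul_right_inj' hn, mul_add, mul_div_cancel₀ _ hn, mul_zero, mul_one, add_comm,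
    add_eq_zero_iff_eq_neg]

lemma canonicalProduct_eq_zero_iff (ha : ∀ n, a n ≤ K * (n + 1)) {s : ℂ} :
    canonicalProduct a s = 0 ↔ ∃ n : ℕ, s = -((n : ℂ) + 1) ∧ 0 < a n := by
  rw [canonicalProduct_eq_split ha (Nat.le_ceil (2 * ‖s‖)) le_rfl]
  simp only [mul_eq_zero, Complex.exp_ne_zero, or_false, Finset.prod_eq_zero_iff, pow_eq_zero_iff',
    weierstrassFactor_div_eq_zero_iff]
  constructor
  · rintro ⟨n, -, h, h'⟩
    exact ⟨n, h, Nat.pos_of_ne_zero h'⟩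
  · rintro ⟨n, h, h'⟩
    refine ⟨n, ?_, h, h'.ne'⟩
    rw [Finset.mem_range, Nat.lt_ceil, h, norm_neg]
    have : ‖(n : ℂ) + 1‖ = (n : ℝ) + 1 := by exact_mod_cast Complex.norm_natCast (n + 1)
    rw [this]
    have hn : (0 : ℝ) ≤ n := n.cast_nonneg
    linarith

lemma canonicalProduct_add (ha : ∀ n, a n ≤ K * (n + 1)) {L : ℕ} (hb : ∀ n, b n ≤ L * (n + 1))
    (s : ℂ) :
    canonicalProduct (fun n ↦ a n + b n) s = canonicalProduct a s * canonicalProduct b s := by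
  rw [← ((hasProd_canonicalProduct ha s).mul (hasProd_canonicalProduct hb s)).tprod_eq]
  simp only [canonicalProduct, pow_add]

lemma canonicalProduct_const_mul (ha : ∀ n, a n ≤ K * (n + 1)) (k : ℕ) (s : ℂ) :
    canonicalProduct (fun n ↦ k * a n) s = canonicalProduct a s ^ k := by
  rw [← ((hasProd_canonicalProduct ha s).pow k).tprod_eq]
  simp only [canonicalProduct, ← pow_mul, mul_comm]

lemma canonicalProduct_sum {ι : Type*} {t : Finset ι} {f : ι → ℕ → ℕ} {k : ι → ℕ}
    (hf : ∀ i ∈ t, ∀ n, f i n ≤ k i * (n + 1)) (s : ℂ) :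
    canonicalProduct (fun n ↦ ∑ i ∈ t, f i n) s = ∏ i ∈ t, canonicalProduct (f i) s := by
  rw [← (hasProd_prod fun i hi ↦ hasProd_canonicalProduct (hf i hi) s).tprod_eq]
  simp only [canonicalProduct, Finset.prod_pow_eq_pow_sum]

/-- Splitting off the zero at `-(k + 1)`. -/
lemma canonicalProduct_eq_pow_mul (ha : ∀ n, a n ≤ K * (n + 1)) (k : ℕ) (s : ℂ) :
    canonicalProduct a s = weierstrassFactor (s / ((k : ℂ) + 1)) ^ a k *
      canonicalProduct (Function.update a k 0) s := by
  have hu : ∀ n, Function.update a k 0 n ≤ K * (n + 1) := fun n ↦ by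
    rcases eq_or_ne n k with rfl | h
    · simp
    · simpa [h] using ha n
  have h1 := hasProd_single (f := fun n : ℕ ↦ weierstrassFactor (s / ((n : ℂ) + 1)) ^
    (if n = k then a k else 0)) k (fun n hn ↦ by simp [hn])
  have h2 := h1.mul (hasProd_canonicalProduct hu s)
  rw [if_pos rfl] at h2
  rw [← h2.tprod_eq, canonicalProduct]
  refine tprod_congr fun n ↦ ?_
  rcases eq_or_ne n k with rfl | h <;> simp [*]

/-- A canonical product with linearly bounded multiplicities has order at most two. -/
lemma exists_norm_canonicalProduct_le (ha : ∀ n, a n ≤ K * (n + 1)) {p : ℝ} (hp2 : 2 < p)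
    (hp3 : p ≤ 3) :
    ∃ C : ℝ, 0 ≤ C ∧ ∀ s, ‖canonicalProduct a s‖ ≤ Real.exp (C * ‖s‖ ^ p) := by
  have hsum : Summable fun n : ℕ ↦ ((n : ℝ) + 1) ^ (1 - p) := by
    have := (summable_nat_add_iff 1).2 (Real.summable_nat_rpow (p := 1 - p).2 (by linarith))
    simpa using this
  refine ⟨16 * K * ∑' n : ℕ, ((n : ℝ) + 1) ^ (1 - p), ?_, fun s ↦ ?_⟩
  · have : 0 ≤ ∑' n : ℕ, ((n : ℝ) + 1) ^ (1 - p) := tsum_nonneg fun n ↦ by positivity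
    positivity
  have hterm : ∀ n : ℕ, ‖weierstrassFactor (s / ((n : ℂ) + 1)) ^ a n‖ ≤
      Real.exp (16 * K * ‖s‖ ^ p * ((n : ℝ) + 1) ^ (1 - p)) := fun n ↦ by
    have hn : (0 : ℝ) < (n : ℝ) + 1 := by positivity
    have ha' : (a n : ℝ) ≤ K * ((n : ℝ) + 1) := by exact_mod_cast ha n
    rw [norm_pow]
    refine (pow_le_pow_left₀ (norm_nonneg _)
      (norm_weierstrassFactor_le hp2.le hp3 _) _).trans ?_
    rw [← Real.exp_nat_mul, Real.exp_le_exp, norm_div_natCast_add_one,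
      Real.div_rpow (norm_nonneg _) hn.le]
    calc (a n : ℝ) * (16 * (‖s‖ ^ p / ((n : ℝ) + 1) ^ p))
        ≤ (K * ((n : ℝ) + 1)) * (16 * (‖s‖ ^ p / ((n : ℝ) + 1) ^ p)) := by gcongr
      _ = _ := by
        rw [Real.rpow_sub hn, Real.rpow_one]
        ring
  refine le_of_tendsto (hasProd_canonicalProduct ha s).tendsto_prod_nat.norm
    (Filter.Eventually.of_forall fun M ↦ ?_)
  rw [norm_prod]
  refine (Finset.prod_le_prod (fun n _ ↦ norm_nonneg _) fun n _ ↦ hterm n).trans ?_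
  rw [← Real.exp_sum, Real.exp_le_exp, ← Finset.mul_sum]
  calc _ ≤ 16 * K * ‖s‖ ^ p * ∑' n : ℕ, ((n : ℝ) + 1) ^ (1 - p) := by
        gcongr
        exact hsum.sum_le_tsum _ fun n _ ↦ by positivity
    _ = _ := by ring

end CanonicalProduct

/-- Functions of the form `exp(A + B s + C s²)`. -/
def IsExpQuadratic (f : ℂ → ℂ) : Prop :=
  ∃ A B C : ℂ, ∀ s, f s = Complex.exp (A + B * s + C * s ^ 2)

namespace IsExpQuadratic

variable {f h : ℂ → ℂ}

lemma mul (hf : IsExpQuadratic f) (hh : IsExpQuadratic h) :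
    IsExpQuadratic fun s ↦ f s * h s := by
  obtain ⟨A, B, C, hf⟩ := hf
  obtain ⟨A', B', C', hh⟩ := hh
  refine ⟨A + A', B + B', C + C', fun s ↦ ?_⟩
  beta_reduce
  rw [hf, hh, ← Complex.exp_add]
  ring_nf

lemma inv (hf : IsExpQuadratic f) : IsExpQuadratic fun s ↦ (f s)⁻¹ := by
  obtain ⟨A, B, C, hf⟩ := hf
  refine ⟨-A, -B, -C, fun s ↦ ?_⟩
  beta_reduce
  rw [hf, ← Complex.exp_neg]
  ring_nf

lemma pow (hf : IsExpQuadratic f) (n : ℕ) : IsExpQuadratic fun s ↦ f s ^ n := by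
  obtain ⟨A, B, C, hf⟩ := hf
  refine ⟨n * A, n * B, n * C, fun s ↦ ?_⟩
  beta_reduce
  rw [hf, ← Complex.exp_nat_mul]
  ring_nf

lemma prod {ι : Type*} (t : Finset ι) {f : ι → ℂ → ℂ} (hf : ∀ i, IsExpQuadratic (f i)) :
    IsExpQuadratic fun s ↦ ∏ i ∈ t, f i s := by
  choose A B C hf using hf
  refine ⟨∑ i ∈ t, A i, ∑ i ∈ t, B i, ∑ i ∈ t, C i, fun s ↦ ?_⟩
  simp only [hf, ← Complex.exp_sum, Finset.sum_add_distrib, Finset.sum_mul]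

lemma comp_affine (hf : IsExpQuadratic f) (x y : ℂ) : IsExpQuadratic fun s ↦ f ((s + x) / y) := by
  obtain ⟨A, B, C, hf⟩ := hf
  refine ⟨A + B * x / y + C * x ^ 2 / y ^ 2, B / y + 2 * C * x / y ^ 2, C / y ^ 2, fun s ↦ ?_⟩
  beta_reduce
  rw [hf]
  ring_nf

lemma ne_zero (hf : IsExpQuadratic f) (s : ℂ) : f s ≠ 0 := by
  obtain ⟨A, B, C, hf⟩ := hf
  rw [hf]
  exact Complex.exp_ne_zero _

lemma differentiable (hf : IsExpQuadratic f) : Differentiable ℂ f := by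
  obtain ⟨A, B, C, hf⟩ := hf
  rw [funext hf]
  fun_prop

lemma two_pi_cpow (x : ℂ) : IsExpQuadratic fun s ↦ (2 * Real.pi : ℂ) ^ (x * s) := by
  refine ⟨0, Complex.log (2 * Real.pi) * x, 0, fun s ↦ ?_⟩
  beta_reduce
  rw [Complex.cpow_def_of_ne_zero (by simp [Real.pi_ne_zero])]
  ring_nf

end IsExpQuadratic

lemma barnesProd_eq_canonicalProduct (z : ℂ) :
    barnesProd z = canonicalProduct (fun n ↦ n + 1) z := by
  refine tprod_congr fun n ↦ ?_
  have hn : (n : ℂ) + 1 ≠ 0 := Nat.cast_add_one_ne_zero n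
  rw [weierstrassFactor, mul_pow, ← Complex.exp_nat_mul]
  congr 2
  push_cast
  field_simp

/-- The multiplicity contributed at `-(n + 1)` by the residue class `r` modulo `d`. -/
def residueMultiplicity (d r n : ℕ) : ℕ :=
  if (n + 1) % d = r then (n + 1) / d else 0

lemma residueMultiplicity_le (d r n : ℕ) : residueMultiplicity d r n ≤ 1 * (n + 1) := by
  rw [residueMultiplicity, one_mul]
  split_ifs
  · exact Nat.div_le_self _ _
  · exact Nat.zero_le _

lemma sum_residueMultiplicity {d : ℕ} (hd : 0 < d) (n : ℕ) :
    ∑ r ∈ Finset.range d, residueMultiplicity d r n = (n + 1) / d := by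
  simp [residueMultiplicity, Finset.sum_ite_eq, Nat.mod_lt _ hd]

/-- The subproduct of a canonical product along a residue class. -/
lemma hasProd_residueMultiplicity {d r : ℕ} (hr : r < d) (s : ℂ) :
    HasProd (fun k : ℕ ↦ weierstrassFactor (s / (d * ((k : ℂ) + 1) + r)) ^ (k + 1))
      (canonicalProduct (residueMultiplicity d r) s) := by
  have hd : 0 < d := by omega
  have hg : ∀ k : ℕ, d * (k + 1) + r - 1 + 1 = d * (k + 1) + r := fun k ↦
    Nat.sub_add_cancel (le_add_right (Nat.mul_pos hd k.succ_pos))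
  have hinj : Function.Injective fun k : ℕ ↦ d * (k + 1) + r - 1 := fun k l hkl ↦ by
    have h : d * (k + 1) + r = d * (l + 1) + r := by
      rw [← hg k, ← hg l]
      exact congrArg (· + 1) hkl
    have := Nat.eq_of_mul_eq_mul_left hd (Nat.add_right_cancel h)
    omega
  convert! (hinj.hasProd_iff fun n hn ↦ ?_).2
    (hasProd_canonicalProduct (residueMultiplicity_le d r) s) using 1
  · funext k
    have hm : residueMultiplicity d r (d * (k + 1) + r - 1) = k + 1 := by
      rw [residueMultiplicity, hg, Nat.mul_add_mod, Nat.mod_eq_of_lt hr, if_pos rfl,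
        Nat.mul_add_div hd, Nat.div_eq_of_lt hr, add_zero]
    have hc : ((d * (k + 1) + r - 1 : ℕ) : ℂ) + 1 = d * ((k : ℂ) + 1) + r := by
      exact_mod_cast hg k
    rw [Function.comp_apply, hm, hc]
  · have hz : residueMultiplicity d r n = 0 := by
      rw [residueMultiplicity]
      split_ifs with h
      · by_contra hne
        obtain ⟨k, hk⟩ := Nat.exists_eq_succ_of_ne_zero hne
        refine hn ⟨k, ?_⟩
        have := Nat.div_add_mod (n + 1) d
        rw [h, hk] at this
        simp only
        rw [Nat.succ_eq_add_one] at this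
        omega
      · rfl
    rw [hz, pow_zero]

/-- Rewriting a Weierstrass factor centred at a shifted point. -/
lemma weierstrassFactor_shift {x y : ℂ} (hx : x ≠ 0) (hxy : x + y ≠ 0) (s : ℂ) :
    weierstrassFactor ((s + y) / x) = weierstrassFactor (s / (x + y)) *
      Complex.exp (weierstrassLog (y / x) + y ^ 2 / (x ^ 2 * (x + y)) * s +
        (1 / x ^ 2 - 1 / (x + y) ^ 2) / 2 * s ^ 2) := by
  have h1 : 1 + y / x ≠ 0 := by
    rw [one_add_div hx]
    exact div_ne_zero hxy hx
  rw [add_assoc, Complex.exp_add, ← weierstrassFactor_eq_exp h1]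
  simp only [weierstrassFactor]
  have h2 : 1 + (s + y) / x = (1 + s / (x + y)) * (1 + y / x) := by
    field_simp
    ring
  have h3 : -((s + y) / x) + ((s + y) / x) ^ 2 / 2 =
      (-(s / (x + y)) + (s / (x + y)) ^ 2 / 2) + (-(y / x) + (y / x) ^ 2 / 2) +
      (y ^ 2 / (x ^ 2 * (x + y)) * s + (1 / x ^ 2 - 1 / (x + y) ^ 2) / 2 * s ^ 2) := by
    field_simp
    ring
  rw [h2, h3, Complex.exp_add, Complex.exp_add]
  ring

lemma summable_mul_weierstrassLog (x : ℂ) :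
    Summable fun k : ℕ ↦ ((k + 1 : ℕ) : ℂ) * weierstrassLog (x / ((k : ℂ) + 1)) := by
  rw [← summable_nat_add_iff ⌈2 * ‖x‖⌉₊]
  exact Summable.of_norm_bounded (summable_one_div_add_one_sq.mul_left ((1 : ℕ) * ‖x‖ ^ 3))
    (norm_mul_weierstrassLog_le (a := fun k ↦ k + 1) (K := 1) (by simp) (Nat.le_ceil _) le_rfl)

lemma summable_shift_linear {d r : ℕ} (hr : r < d) :
    Summable fun k : ℕ ↦ ((k + 1 : ℕ) : ℂ) * ((r : ℂ) ^ 2 /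
      ((d * ((k : ℂ) + 1)) ^ 2 * (d * ((k : ℂ) + 1) + r))) := by
  refine Summable.of_norm_bounded summable_one_div_add_one_sq fun k ↦ ?_
  have hrd : (r : ℝ) ≤ d := by exact_mod_cast hr.le
  have hd : (1 : ℝ) ≤ d := by exact_mod_cast (by omega : 1 ≤ d)
  have hr0 : (0 : ℝ) ≤ r := r.cast_nonneg
  have hk : (0 : ℝ) < (k : ℝ) + 1 := by positivity
  have e : ((k + 1 : ℕ) : ℂ) * ((r : ℂ) ^ 2 /
      ((d * ((k : ℂ) + 1)) ^ 2 * (d * ((k : ℂ) + 1) + r))) =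
      ((((k : ℝ) + 1) * ((r : ℝ) ^ 2 /
      ((d * ((k : ℝ) + 1)) ^ 2 * (d * ((k : ℝ) + 1) + r))) : ℝ) : ℂ) := by push_cast; rfl
  rw [e, Complex.norm_real, Real.norm_of_nonneg (by positivity)]
  calc ((k : ℝ) + 1) * ((r : ℝ) ^ 2 / ((d * ((k : ℝ) + 1)) ^ 2 * (d * ((k : ℝ) + 1) + r)))
      ≤ ((k : ℝ) + 1) * ((d : ℝ) ^ 2 / ((d * ((k : ℝ) + 1)) ^ 2 * (1 * ((k : ℝ) + 1) + 0))) := by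
        gcongr
    _ = _ := by field_simp; ring

lemma summable_shift_quadratic {d r : ℕ} (hr : r < d) :
    Summable fun k : ℕ ↦ ((k + 1 : ℕ) : ℂ) * ((1 / (d * ((k : ℂ) + 1)) ^ 2 -
      1 / (d * ((k : ℂ) + 1) + r) ^ 2) / 2) := by
  refine Summable.of_norm_bounded summable_one_div_add_one_sq fun k ↦ ?_
  have hrd : (r : ℝ) ≤ d := by exact_mod_cast hr.le
  have hd : (1 : ℝ) ≤ d := by exact_mod_cast (by omega : 1 ≤ d)
  have hr0 : (0 : ℝ) ≤ r := r.cast_nonneg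
  have hk : (0 : ℝ) < (k : ℝ) + 1 := by positivity
  have e : ((k + 1 : ℕ) : ℂ) * ((1 / (d * ((k : ℂ) + 1)) ^ 2 -
      1 / (d * ((k : ℂ) + 1) + r) ^ 2) / 2) =
      ((((k : ℝ) + 1) * ((1 / (d * ((k : ℝ) + 1)) ^ 2 -
      1 / (d * ((k : ℝ) + 1) + r) ^ 2) / 2) : ℝ) : ℂ) := by push_cast; rfl
  have hx : (0 : ℝ) < d * ((k : ℝ) + 1) := by positivity
  have hsub : 1 / (d * ((k : ℝ) + 1)) ^ 2 - 1 / (d * ((k : ℝ) + 1) + r) ^ 2 =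
      r * (2 * (d * ((k : ℝ) + 1)) + r) /
        ((d * ((k : ℝ) + 1)) ^ 2 * (d * ((k : ℝ) + 1) + r) ^ 2) := by
    field_simp
    ring
  rw [e, Complex.norm_real, hsub, Real.norm_of_nonneg (by positivity)]
  calc ((k : ℝ) + 1) * (r * (2 * (d * ((k : ℝ) + 1)) + r) /
        ((d * ((k : ℝ) + 1)) ^ 2 * (d * ((k : ℝ) + 1) + r) ^ 2) / 2)
      ≤ ((k : ℝ) + 1) * (d * (2 * (d * ((k : ℝ) + 1) + r)) /
        ((d * ((k : ℝ) + 1)) ^ 2 * (d * ((k : ℝ) + 1) + r) ^ 2) / 2) := by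
        gcongr
        linarith
    _ = ((k : ℝ) + 1) * (d / ((d * ((k : ℝ) + 1)) ^ 2 * (d * ((k : ℝ) + 1) + r))) := by
        field_simp
    _ ≤ ((k : ℝ) + 1) * (d / ((d * ((k : ℝ) + 1)) ^ 2 * (1 * ((k : ℝ) + 1) + 0))) := by
        gcongr
    _ = 1 / ((k : ℝ) + 1) ^ 2 / d := by field_simp; ring
    _ ≤ _ := div_le_self (by positivity) hd

/-- Up to an exponential factor, `barnesProd ((s + r) / d)` is a residue-class subproduct. -/
lemma exists_barnesProd_shift_eq {d r : ℕ} (hr : r < d) :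
    ∃ q, IsExpQuadratic q ∧ ∀ s, barnesProd ((s + r) / d) =
      q s * canonicalProduct (residueMultiplicity d r) s := by
  have hd : (d : ℂ) ≠ 0 := Nat.cast_ne_zero.2 (by omega)
  obtain ⟨A, hA⟩ := summable_mul_weierstrassLog ((r : ℂ) / d)
  obtain ⟨B, hB⟩ := summable_shift_linear hr
  obtain ⟨C, hC⟩ := summable_shift_quadratic hr
  refine ⟨_, ⟨A, B, C, fun s ↦ rfl⟩, fun s ↦ ?_⟩
  have hexp := ((hA.add (hB.mul_right s)).add (hC.mul_right (s ^ 2))).cexp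
  have h := hexp.mul (hasProd_residueMultiplicity hr s)
  rw [barnesProd_eq_canonicalProduct]
  refine (HasProd.tprod_eq ?_ : canonicalProduct _ _ = _)
  convert! h using 1
  funext k
  have hk : (k : ℂ) + 1 ≠ 0 := Nat.cast_add_one_ne_zero k
  have hx : (d : ℂ) * ((k : ℂ) + 1) ≠ 0 := mul_ne_zero hd hk
  have hxy : (d : ℂ) * ((k : ℂ) + 1) + r ≠ 0 := by
    have : d * (k + 1) + r ≠ 0 := by
      exact (Nat.add_pos_left (Nat.mul_pos (by omega) k.succ_pos) r).ne'
    exact_mod_cast this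
  rw [div_div, weierstrassFactor_shift hx hxy, mul_pow, ← Complex.exp_nat_mul, mul_comm,
    Function.comp_apply, div_div]
  congr 2
  ring

/-- The Weierstrass product of `1 / Γ`, up to an exponential factor. -/
lemma exists_inv_Gamma_eq :
    ∃ q, IsExpQuadratic q ∧ ∀ s, Complex.Gamma s ≠ 0 →
      (Complex.Gamma s)⁻¹ = q s * (s * canonicalProduct (fun _ ↦ 1) s) := by
  have hsq := Complex.hasSum_ofReal.2 summable_one_div_add_one_sq.hasSum
  refine ⟨_, ⟨0, Real.eulerMascheroniConstant,
    -(((∑' n : ℕ, 1 / ((n : ℝ) + 1) ^ 2 : ℝ) : ℂ) / 2), fun s ↦ rfl⟩, fun s hs ↦ ?_⟩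
  have hseq := (Complex.GammaSeq_tendsto_Gamma s).inv₀ hs
  refine tendsto_nhds_unique hseq ?_
  have hγ : Filter.Tendsto (fun n : ℕ ↦ (((harmonic n : ℝ) - Real.log n : ℝ) : ℂ)) Filter.atTop
      (nhds (Real.eulerMascheroniConstant : ℂ)) :=
    (Complex.continuous_ofReal.tendsto _).comp Real.tendsto_harmonic_sub_log
  have hprod := (hasProd_canonicalProduct (a := fun _ ↦ 1) (K := 1) (by simp) s).tendsto_prod_nat
  have hlim := ((Complex.continuous_exp.tendsto _).comp
    (((hγ.mul_const s).const_add 0).add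
      (((hsq.tendsto_sum_nat.div_const 2).neg).mul_const (s ^ 2)))).mul (hprod.const_mul s)
  refine hlim.congr' ?_
  filter_upwards [Filter.eventually_gt_atTop 0] with n hn
  have hn0 : (n : ℂ) ≠ 0 := Nat.cast_ne_zero.2 hn.ne'
  have hfac : (n.factorial : ℂ) = ∏ j ∈ Finset.range n, ((j : ℂ) + 1) := by
    rw [← Finset.prod_range_add_one_eq_factorial]
    push_cast
    rfl
  have hW : ∀ j : ℕ, weierstrassFactor (s / ((j : ℂ) + 1)) ^ 1 = (s + (j + 1 : ℕ)) / ((j : ℂ) + 1) *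
      Complex.exp (-(s * ((j : ℂ) + 1)⁻¹) + s ^ 2 / 2 * (((1 / ((j : ℝ) + 1) ^ 2 : ℝ)) : ℂ)) := by
    intro j
    have hj : (j : ℂ) + 1 ≠ 0 := Nat.cast_add_one_ne_zero j
    rw [pow_one, weierstrassFactor]
    congr 1
    · push_cast
      field_simp
      ring
    · congr 1
      push_cast
      field_simp
  have hH : (((harmonic n : ℝ)) : ℂ) = ∑ j ∈ Finset.range n, ((j : ℂ) + 1)⁻¹ := by
    simp [harmonic]
  rw [Complex.GammaSeq, Finset.prod_range_succ', Complex.cpow_def_of_ne_zero hn0, hfac,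
    Function.comp_apply, Finset.prod_congr rfl fun j _ ↦ hW j, Finset.prod_mul_distrib,
    Finset.prod_div_distrib, ← Complex.exp_sum, Finset.sum_add_distrib, ← Finset.mul_sum,
    Finset.sum_neg_distrib, ← Finset.mul_sum, ← hH]
  set H : ℂ := ((harmonic n : ℝ) : ℂ)
  set S : ℂ := ∑ i ∈ Finset.range n, ((1 / ((i : ℝ) + 1) ^ 2 : ℝ) : ℂ)
  set Q : ℂ := ∏ j ∈ Finset.range n, ((j : ℂ) + 1)
  set F : ℂ := ∏ j ∈ Finset.range n, (s + (j + 1 : ℕ))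
  have hexp : Complex.exp (0 + ((harmonic n - Real.log n : ℝ) : ℂ) * s + -(S / 2) * s ^ 2) *
      Complex.exp (-(s * H) + s ^ 2 / 2 * S) = (Complex.exp (Complex.log n * s))⁻¹ := by
    rw [← Complex.exp_add, ← Complex.exp_neg, Complex.ofReal_sub, ← Complex.natCast_log]
    congr 1
    ring
  calc _ = s * (F / Q) * (Complex.exp (Complex.log n * s))⁻¹ := by
        rw [← hexp]
        ring
    _ = _ := by
        rw [Nat.cast_zero, add_zero, inv_div]
        field_simp

lemma exists_barnesG1_eq :
    ∃ q, IsExpQuadratic q ∧ ∀ s, barnesG1 s = q s * barnesProd s := by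
  refine ⟨fun s ↦ (2 * Real.pi : ℂ) ^ ((1 / 2) * s) *
    Complex.exp (-(((1 + (Real.eulerMascheroniConstant : ℂ)) * s ^ 2 + s) / 2)),
    (IsExpQuadratic.two_pi_cpow _).mul
      ⟨0, -1 / 2, -(1 + (Real.eulerMascheroniConstant : ℂ)) / 2, fun s ↦ ?_⟩, fun s ↦ ?_⟩
  · beta_reduce
    congr 1
    ring
  · beta_reduce
    rw [barnesG1, one_div_mul_eq_div]

lemma exists_barnesGE_eq (e : ℕ) {d : Fin e → ℕ} (hd : ∀ i, 0 < d i) :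
    ∃ q, IsExpQuadratic q ∧ ∀ s, barnesGE e d s =
      q s * canonicalProduct (fun n ↦ ∑ i, (n + 1) / d i) s := by
  obtain ⟨q₀, hq₀, h₀⟩ := exists_barnesG1_eq
  have hshift : ∀ i (r : ℕ), ∃ q, IsExpQuadratic q ∧ (r < d i → ∀ s,
      barnesG1 ((s + r) / d i) = q s * canonicalProduct (residueMultiplicity (d i) r) s) := by
    intro i r
    by_cases hr : r < d i
    · obtain ⟨q, hq, h⟩ := exists_barnesProd_shift_eq hr
      refine ⟨_, (hq₀.comp_affine r (d i)).mul hq, fun _ s ↦ ?_⟩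
      rw [h₀, h, mul_assoc]
    · exact ⟨q₀, hq₀, fun h ↦ absurd h hr⟩
  choose q hq h using hshift
  refine ⟨fun s ↦ ∏ i, ∏ r ∈ Finset.range (d i), q i r s,
    IsExpQuadratic.prod _ fun i ↦ IsExpQuadratic.prod _ fun r ↦ hq i r, fun s ↦ ?_⟩
  rw [canonicalProduct_sum (k := fun _ ↦ 1)
    fun i _ n ↦ (Nat.div_le_self _ _).trans (one_mul (n + 1)).ge, ← Finset.prod_mul_distrib]
  refine Finset.prod_congr rfl fun i _ ↦ ?_
  simp only [← sum_residueMultiplicity (hd i)]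
  rw [canonicalProduct_sum (k := fun _ ↦ 1) fun r _ n ↦ residueMultiplicity_le _ _ _,
    ← Finset.prod_mul_distrib]
  exact Finset.prod_congr rfl fun r hr ↦ h i r (Finset.mem_range.1 hr) s

lemma IsExpQuadratic.exists_norm_le {q : ℂ → ℂ} (hq : IsExpQuadratic q) {p : ℝ} (hp : 2 ≤ p) :
    ∃ T : ℝ, 0 ≤ T ∧ ∀ s, ‖q s‖ ≤ Real.exp (T * (max 1 ‖s‖) ^ p) := by
  obtain ⟨A, B, C, hq⟩ := hq
  refine ⟨‖A‖ + ‖B‖ + ‖C‖, by positivity, fun s ↦ ?_⟩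
  rw [hq, Complex.norm_exp, Real.exp_le_exp]
  refine (Complex.re_le_norm _).trans ?_
  set X := max 1 ‖s‖
  have h1 : 1 ≤ X := le_max_left _ _
  have hs : ‖s‖ ≤ X := le_max_right _ _
  have h2 : X ^ 2 ≤ X ^ p := by
    rw [← Real.rpow_two]
    exact Real.rpow_le_rpow_of_exponent_le h1 hp
  have hX : X ≤ X ^ 2 := by nlinarith
  have hs2 : ‖s‖ ^ 2 ≤ X ^ 2 := by gcongr
  calc ‖A + B * s + C * s ^ 2‖ ≤ ‖A‖ * 1 + ‖B‖ * ‖s‖ + ‖C‖ * ‖s‖ ^ 2 := by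
        refine (norm_add₃_le).trans ?_
        simp
    _ ≤ ‖A‖ * X ^ p + ‖B‖ * X ^ p + ‖C‖ * X ^ p := by
        gcongr <;> linarith
    _ = _ := by ring

lemma exists_mul_rpow_le_add_rpow {T p r : ℝ} (hT : 0 ≤ T) (hp : 0 ≤ p) (hpr : p < r) :
    ∃ D : ℝ, ∀ x : ℝ, 1 ≤ x → T * x ^ p ≤ D + x ^ r := by
  refine ⟨T * (T ^ (r - p)⁻¹) ^ p, fun x hx ↦ ?_⟩
  have hx0 : 0 < x := by linarith
  have hrp : 0 < r - p := by linarith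
  rcases le_total T (x ^ (r - p)) with h | h
  · have : T * x ^ p ≤ x ^ r := by
      calc T * x ^ p ≤ x ^ (r - p) * x ^ p := by gcongr
        _ = x ^ r := by rw [← Real.rpow_add hx0, sub_add_cancel]
    have h' : 0 ≤ T * (T ^ (r - p)⁻¹) ^ p := by positivity
    linarith
  · have hxT : x ≤ T ^ (r - p)⁻¹ := by
      calc x = (x ^ (r - p)) ^ (r - p)⁻¹ := (Real.rpow_rpow_inv hx0.le hrp.ne').symm
        _ ≤ _ := by gcongr
    have : T * x ^ p ≤ T * (T ^ (r - p)⁻¹) ^ p := by gcongr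
    have h' : 0 ≤ x ^ r := by positivity
    linarith

/-- Finite-order growth of a canonical product times a power and an exponential factor. -/
lemma exists_norm_mul_canonicalProduct_le {q : ℂ → ℂ} (hq : IsExpQuadratic q) (N : ℕ)
    {a : ℕ → ℕ} {K : ℕ} (ha : ∀ n, a n ≤ K * (n + 1)) {ε : ℝ} (hε : 0 < ε) :
    ∃ C : ℝ, 0 < C ∧ ∀ s, ‖q s * s ^ N * canonicalProduct a s‖ ≤
      C * Real.exp (‖s‖ ^ (2 + ε)) := by
  obtain ⟨p, hp2, hp3, hpε⟩ : ∃ p : ℝ, 2 < p ∧ p ≤ 3 ∧ p < 2 + ε :=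
    ⟨2 + min (ε / 2) 1, by simp [hε], by linarith [min_le_right (ε / 2) 1],
      by linarith [min_le_left (ε / 2) 1]⟩
  obtain ⟨T, hT, hqT⟩ := hq.exists_norm_le hp2.le
  obtain ⟨C, hC, hPC⟩ := exists_norm_canonicalProduct_le ha hp2 hp3
  obtain ⟨D, hD⟩ := exists_mul_rpow_le_add_rpow (T := T + N + C) (by positivity)
    (by linarith) hpε
  refine ⟨Real.exp (D + 1), Real.exp_pos _, fun s ↦ ?_⟩
  set X := max 1 ‖s‖
  have h1 : 1 ≤ X := le_max_left _ _
  have hs : ‖s‖ ≤ X := le_max_right _ _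
  have hXp : X ≤ X ^ p := by
    simpa using Real.rpow_le_rpow_of_exponent_le h1 (by linarith : (1 : ℝ) ≤ p)
  have hpow : ‖s ^ N‖ ≤ Real.exp (N * X ^ p) := by
    rw [norm_pow, Real.exp_nat_mul]
    gcongr
    linarith [Real.add_one_le_exp (X ^ p)]
  have hP : ‖canonicalProduct a s‖ ≤ Real.exp (C * X ^ p) := by
    refine (hPC s).trans ?_
    gcongr
  have hXr : X ^ (2 + ε) ≤ 1 + ‖s‖ ^ (2 + ε) := by
    have h0 : 0 ≤ ‖s‖ ^ (2 + ε) := by positivity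
    rcases max_choice 1 ‖s‖ with h | h
    · simp only [X, h, Real.one_rpow]
      linarith
    · simp only [X, h]
      linarith
  rw [norm_mul, norm_mul]
  calc ‖q s‖ * ‖s ^ N‖ * ‖canonicalProduct a s‖
      ≤ Real.exp (T * X ^ p) * Real.exp (N * X ^ p) * Real.exp (C * X ^ p) := by
        gcongr
        exact hqT s
    _ = Real.exp ((T + N + C) * X ^ p) := by
        rw [← Real.exp_add, ← Real.exp_add]
        ring_nf
    _ ≤ Real.exp (D + 1 + ‖s‖ ^ (2 + ε)) := by
        gcongr
        linarith [hD X h1]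
    _ = _ := Real.exp_add _ _

/-- The local factorization of a canonical product at `-(k + 1)`. -/
lemma exists_canonicalProduct_eq_pow_mul {a : ℕ → ℕ} {K : ℕ} (ha : ∀ n, a n ≤ K * (n + 1))
    (k : ℕ) :
    ∃ h : ℂ → ℂ, Differentiable ℂ h ∧ h (-((k : ℂ) + 1)) ≠ 0 ∧
      ∀ s, canonicalProduct a s = (s + ((k : ℂ) + 1)) ^ a k * h s := by
  have hu : ∀ n, Function.update a k 0 n ≤ K * (n + 1) := fun n ↦ by
    rcases eq_or_ne n k with rfl | h
    · simp
    · simpa [h] using ha n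
  have hk : (k : ℂ) + 1 ≠ 0 := Nat.cast_add_one_ne_zero k
  refine ⟨fun s ↦ (Complex.exp (-(s / ((k : ℂ) + 1)) + (s / ((k : ℂ) + 1)) ^ 2 / 2) /
    ((k : ℂ) + 1)) ^ a k * canonicalProduct (Function.update a k 0) s, ?_, ?_, fun s ↦ ?_⟩
  · exact Differentiable.mul (by fun_prop) (differentiable_canonicalProduct hu)
  · refine mul_ne_zero (pow_ne_zero _ (div_ne_zero (Complex.exp_ne_zero _) hk)) ?_
    rw [Ne, canonicalProduct_eq_zero_iff hu]
    rintro ⟨n, hn, hpos⟩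
    have hkn : k = n := by exact_mod_cast add_right_cancel (neg_injective hn)
    simp [hkn] at hpos
  · rw [canonicalProduct_eq_pow_mul ha k, ← mul_assoc, ← mul_pow]
    congr 2
    rw [weierstrassFactor]
    field_simp
    ring

/-- The function
`G₁(s) = ((2π)^{−s} G(s+1)²/Γ(s))^{2g−2+c} ((2π)^{−s} G(s+1)²)^{e} G_E(s)^{−2}`
extends to an entire function of order at most two whose zeros are exactly the points
`s = −n`, `n ∈ ℕ`, with `mₙ > 0`, the zero at `−n` having multiplicity exactly
`mₙ = (2n+1)(2g−2+c) + 2ne − 2∑ᵢ ⌊n/dᵢ⌋`. -/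
theorem G1_entire_order_two_zeros (g c : ℤ) (hgc : 0 ≤ 2 * g - 2 + c)
    (e : ℕ) (d : Fin e → ℕ) (hd : ∀ i, 2 ≤ d i)
    (m : ℕ → ℤ)
    (hm : ∀ n : ℕ, m n = (2 * n + 1) * (2 * g - 2 + c) + 2 * n * e
      - 2 * ∑ i, ((n / d i : ℕ) : ℤ)) :
    ∃ G₁ : ℂ → ℂ, Differentiable ℂ G₁ ∧
      (∀ s : ℂ, barnesGE e d s ≠ 0 → Complex.Gamma s ≠ 0 →
        G₁ s = ((2 * Real.pi : ℂ) ^ (-s) * barnesG1 s ^ 2 / Complex.Gamma s) ^ (2 * g - 2 + c)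
          * ((2 * Real.pi : ℂ) ^ (-s) * barnesG1 s ^ 2) ^ e
          * (barnesGE e d s) ^ (-2 : ℤ)) ∧
      (∀ ε : ℝ, 0 < ε → ∃ C : ℝ, 0 < C ∧
        ∀ s : ℂ, ‖G₁ s‖ ≤ C * Real.exp (‖s‖ ^ (2 + ε))) ∧
      (∀ s : ℂ, G₁ s = 0 ↔ ∃ n : ℕ, s = -(n : ℂ) ∧ 0 < m n) ∧
      (∀ n : ℕ, 0 < m n → ∃ h : ℂ → ℂ, AnalyticAt ℂ h (-(n : ℂ)) ∧ h (-(n : ℂ)) ≠ 0 ∧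
        ∀ᶠ s in nhds (-(n : ℂ)), G₁ s = (s + n) ^ (m n).toNat * h s) := by
  obtain ⟨N, hN⟩ := Int.eq_ofNat_of_zero_le hgc
  have hd0 : ∀ i, 0 < d i := fun i ↦ zero_lt_two.trans_le (hd i)
  set b : ℕ → ℕ := fun k ↦ ∑ i, (k + 1) / d i with hb
  have hbe : ∀ k, b k ≤ e * (k + 1) := fun k ↦ by
    simpa using Finset.sum_le_card_nsmul Finset.univ (fun i ↦ (k + 1) / d i) (k + 1)
      fun i _ ↦ Nat.div_le_self _ _
  obtain ⟨a, ha⟩ : ∃ a : ℕ → ℕ, ∀ k, a k + 2 * b k = N * (2 * (k + 1) + 1) + 2 * e * (k + 1) :=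
    ⟨fun k ↦ N * (2 * (k + 1) + 1) + 2 * (e * (k + 1) - b k), fun k ↦ by
      beta_reduce
      rw [mul_assoc 2 e]
      have := hbe k
      omega⟩
  have haK : ∀ k, a k ≤ (3 * N + 2 * e) * (k + 1) := fun k ↦ by
    nlinarith [ha k, Nat.zero_le (N * k)]
  have hm0 : m 0 = N := by simp [hm, hN]
  have hmk : ∀ k : ℕ, m (k + 1) = a k := fun k ↦ by
    have h : ((a k : ℤ) + 2 * ∑ i, (((k + 1) / d i : ℕ) : ℤ)) =
        N * (2 * (k + 1) + 1) + 2 * e * (k + 1) := by exact_mod_cast ha k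
    rw [hm, hN]
    push_cast at h ⊢
    linarith
  obtain ⟨qE, hqE, hE⟩ := exists_barnesGE_eq e hd0
  obtain ⟨qB, hqB, hB⟩ := exists_barnesG1_eq
  obtain ⟨qΓ, hqΓ, hΓ⟩ := exists_inv_Gamma_eq
  have hq2π : IsExpQuadratic fun s ↦ (2 * Real.pi : ℂ) ^ (-s) := by
    simpa using IsExpQuadratic.two_pi_cpow (-1)
  have hqF := hq2π.mul (hqB.pow 2)
  obtain ⟨q, hq, hqdef⟩ : ∃ q, IsExpQuadratic q ∧ ∀ s, q s =
      ((2 * Real.pi : ℂ) ^ (-s) * qB s ^ 2 * qΓ s) ^ N * ((2 * Real.pi : ℂ) ^ (-s) * qB s ^ 2) ^ e *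
        ((qE s)⁻¹) ^ 2 :=
    ⟨_, (((hqF.mul hqΓ).pow N).mul (hqF.pow e)).mul (hqE.inv.pow 2), fun s ↦ rfl⟩
  have hprod : ∀ s, canonicalProduct a s * canonicalProduct b s ^ 2 =
      (canonicalProduct (fun n ↦ n + 1) s ^ 2 * canonicalProduct (fun _ ↦ 1) s) ^ N *
        (canonicalProduct (fun n ↦ n + 1) s ^ 2) ^ e := fun s ↦ by
    have h1 : ∀ n, (fun n ↦ n + 1) n ≤ 1 * (n + 1) := by simp
    have h2 : ∀ n : ℕ, 2 * (n + 1) ≤ 2 * (n + 1) := fun n ↦ le_rfl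
    have h3 : ∀ n : ℕ, 2 * (n + 1) + 1 ≤ 3 * (n + 1) := fun n ↦ by omega
    have h4 : ∀ n : ℕ, (fun _ ↦ 1) n ≤ 1 * (n + 1) := by simp
    rw [← canonicalProduct_const_mul hbe, ← canonicalProduct_add haK
        (L := 2 * e) (fun n ↦ by nlinarith [hbe n]), ← canonicalProduct_const_mul h1,
      ← canonicalProduct_add h2 h4, ← canonicalProduct_const_mul h3,
      ← canonicalProduct_const_mul h2, ← canonicalProduct_add (K := 3 * N) (L := 2 * e)
        (fun n ↦ by nlinarith [Nat.zero_le (N * n)]) (fun n ↦ by nlinarith)]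
    congr 1
    funext k
    rw [ha]
    ring
  refine ⟨fun s ↦ q s * s ^ N * canonicalProduct a s,
    (hq.differentiable.mul (differentiable_id.pow N)).mul (differentiable_canonicalProduct haK),
    fun s hEs hΓs ↦ ?_, fun ε hε ↦ exists_norm_mul_canonicalProduct_le hq N haK hε,
    fun s ↦ ?_, fun n hn ↦ ?_⟩
  · have hbs : canonicalProduct b s ≠ 0 := fun h ↦ hEs (by rw [hE, h, mul_zero])
    have hqEs := hqE.ne_zero s
    beta_reduce
    rw [hN, zpow_natCast, div_eq_mul_inv, hΓ s hΓs, hB,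
      barnesProd_eq_canonicalProduct, hE, zpow_neg, zpow_ofNat, hqdef]
    rw [← mul_right_inj' (pow_ne_zero 2 hbs)]
    calc _ = (((2 * Real.pi : ℂ) ^ (-s) * qB s ^ 2 * qΓ s) ^ N *
          ((2 * Real.pi : ℂ) ^ (-s) * qB s ^ 2) ^ e * ((qE s)⁻¹) ^ 2) * s ^ N *
          (canonicalProduct a s * canonicalProduct b s ^ 2) := by ring
      _ = _ := by
        rw [hprod]
        simp only [← hb]
        field_simp
        simp only [mul_pow]
        ring
  · simp only [mul_eq_zero, hq.ne_zero s, false_or, pow_eq_zero_iff',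
      canonicalProduct_eq_zero_iff haK]
    constructor
    · rintro (⟨rfl, h⟩ | ⟨k, hk, h⟩)
      · exact ⟨0, by simp, by rw [hm0]; exact_mod_cast Nat.pos_of_ne_zero h⟩
      · exact ⟨k + 1, by push_cast; exact hk, by rw [hmk]; exact_mod_cast h⟩
    · rintro ⟨_ | k, hs, h⟩
      · rw [hm0] at h
        exact .inl ⟨by simpa using hs, by exact_mod_cast h.ne'⟩
      · rw [hmk] at h
        exact .inr ⟨k, by push_cast at hs; exact hs, by exact_mod_cast h⟩
  · rcases n with _ | k
    · refine ⟨fun s ↦ q s * canonicalProduct a s,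
        (hq.differentiable.mul (differentiable_canonicalProduct haK)).analyticAt _,
        mul_ne_zero (hq.ne_zero _) ?_, Filter.Eventually.of_forall fun s ↦ ?_⟩
      · rw [Ne, canonicalProduct_eq_zero_iff haK]
        rintro ⟨k, hk, -⟩
        rw [Nat.cast_zero, neg_zero, eq_comm, neg_eq_zero] at hk
        exact Nat.cast_add_one_ne_zero k hk
      · rw [hm0, Int.toNat_natCast, Nat.cast_zero, add_zero]
        ring
    · obtain ⟨h, hdiff, hne, heq⟩ := exists_canonicalProduct_eq_pow_mul haK k
      refine ⟨fun s ↦ q s * s ^ N * h s,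
        ((hq.differentiable.mul (differentiable_id.pow N)).mul hdiff).analyticAt _, ?_,
        Filter.Eventually.of_forall fun s ↦ ?_⟩
      · rw [Nat.cast_succ]
        exact mul_ne_zero (mul_ne_zero (hq.ne_zero _)
          (pow_ne_zero _ (neg_ne_zero.2 (Nat.cast_add_one_ne_zero k)))) hne
      · beta_reduce
        rw [hmk, Int.toNat_natCast, Nat.cast_succ, heq]
        ring
end
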